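/- Let β > α > 0 and V > 0. There exists ε₀ > 0 (depending on α, β and V) such that for every ε ∈ [0, ε₀) and every y > 0 with y ≠ 1, one has θ₃(βVy)·θ₃(βV/y) + ε·θ₄(αVy)·θ₄(αV/y) > θ₃(βV)² + ε·θ₄(αV)²; that is, the square lattice is the unique minimizer of the energy E^±_{f₁,εf₂} with Gaussian potentials among two-dimensional rectangular lattices of covolume V for all sufficiently small ε ≥ 0. -/

import Mathlib

noncomputable section

/-- Jacobi theta function `θ₃(x) = Σ_{k∈ℤ} e^{-πxk²}`. -/
def theta3 (x : ℝ) : ℝ := ∑' k : ℤ, Real.exp (-Real.pi * x * (k : ℝ) ^ 2)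

/-- Jacobi theta function `θ₄(x) = Σ_{k∈ℤ} (-1)^k e^{-πxk²}`. -/
def theta4 (x : ℝ) : ℝ := ∑' k : ℤ, (-1 : ℝ) ^ k * Real.exp (-Real.pi * x * (k : ℝ) ^ 2)

/-- `F_{α,β,V}(y) = θ₃(βVy)θ₃(βV/y) + θ₄(αVy)θ₄(αV/y)`, the (shifted)
alternating-charge Gaussian energy of the rectangular lattice
`√(Vy)ℤ × √(V/y)ℤ`. -/
def FV (α β V y : ℝ) : ℝ :=
  theta3 (β * V * y) * theta3 (β * V / y) + theta4 (α * V * y) * theta4 (α * V / y)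

open Real Set

/-- The weighted Gaussian moment `Σ_{k∈ℤ} c(k) (πk²)^j e^{-πxk²}`. -/
def thetaMoment (c : ℤ → ℝ) (j : ℕ) (x : ℝ) : ℝ :=
  ∑' k : ℤ, c k * (π * (k : ℝ) ^ 2) ^ j * exp (-π * x * (k : ℝ) ^ 2)

lemma summable_gaussian_moment (j : ℕ) {x : ℝ} (hx : 0 < x) :
    Summable fun k : ℤ => (π * (k : ℝ) ^ 2) ^ j * exp (-π * x * (k : ℝ) ^ 2) := by
  have h := (summable_pow_mul_jacobiTheta₂_term_bound 0 hx (2 * j)).mul_left (π ^ j)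
  refine h.congr fun k => ?_
  rw [pow_mul, Int.cast_abs, sq_abs, mul_pow]
  ring_nf

lemma norm_thetaMoment_term_le {c : ℤ → ℝ} (hc : ∀ k, |c k| ≤ 1) (j : ℕ) {x y : ℝ}
    (hxy : x ≤ y) (k : ℤ) :
    ‖c k * (π * (k : ℝ) ^ 2) ^ j * exp (-π * y * (k : ℝ) ^ 2)‖
      ≤ (π * (k : ℝ) ^ 2) ^ j * exp (-π * x * (k : ℝ) ^ 2) := by
  have h : 0 ≤ (π * (k : ℝ) ^ 2) ^ j := by positivity
  rw [norm_mul, norm_mul, norm_of_nonneg h, norm_of_nonneg (exp_pos _).le, norm_eq_abs]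
  have he : exp (-π * y * (k : ℝ) ^ 2) ≤ exp (-π * x * (k : ℝ) ^ 2) := by
    rw [exp_le_exp]
    nlinarith [mul_nonneg (mul_nonneg pi_pos.le (sq_nonneg (k : ℝ))) (sub_nonneg.2 hxy)]
  exact mul_le_mul (mul_le_of_le_one_left h (hc k)) he (exp_pos _).le h

lemma summable_thetaMoment {c : ℤ → ℝ} (hc : ∀ k, |c k| ≤ 1) (j : ℕ) {x : ℝ} (hx : 0 < x) :
    Summable fun k : ℤ => c k * (π * (k : ℝ) ^ 2) ^ j * exp (-π * x * (k : ℝ) ^ 2) :=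
  .of_norm_bounded (summable_gaussian_moment j hx) (norm_thetaMoment_term_le hc j le_rfl)

lemma hasDerivAt_thetaMoment {c : ℤ → ℝ} (hc : ∀ k, |c k| ≤ 1) (j : ℕ) {x : ℝ} (hx : 0 < x) :
    HasDerivAt (thetaMoment c j) (-thetaMoment c (j + 1) x) x := by
  have hx' : x ∈ Ioi (x / 2) := half_lt_self hx
  have hd (k : ℤ) (y : ℝ) (_ : y ∈ Ioi (x / 2)) :
      HasDerivAt (fun y => c k * (π * (k : ℝ) ^ 2) ^ j * exp (-π * y * (k : ℝ) ^ 2))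
        (-(c k * (π * (k : ℝ) ^ 2) ^ (j + 1) * exp (-π * y * (k : ℝ) ^ 2))) y := by
    have h : HasDerivAt (fun z : ℝ => -π * z * (k : ℝ) ^ 2) (-π * (k : ℝ) ^ 2) y := by
      simpa using ((hasDerivAt_id y).const_mul (-π)).mul_const ((k : ℝ) ^ 2)
    refine (h.exp.const_mul (c k * (π * (k : ℝ) ^ 2) ^ j)).congr_deriv ?_
    ring
  have hb (k : ℤ) (y : ℝ) (hy : y ∈ Ioi (x / 2)) :
      ‖-(c k * (π * (k : ℝ) ^ 2) ^ (j + 1) * exp (-π * y * (k : ℝ) ^ 2))‖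
        ≤ (π * (k : ℝ) ^ 2) ^ (j + 1) * exp (-π * (x / 2) * (k : ℝ) ^ 2) := by
    rw [norm_neg]
    exact norm_thetaMoment_term_le hc (j + 1) (le_of_lt hy) k
  have h := hasDerivAt_tsum_of_isPreconnected (summable_gaussian_moment (j + 1) (half_pos hx))
    isOpen_Ioi isPreconnected_Ioi hd hb hx' (summable_thetaMoment hc j hx) hx'
  rw [tsum_neg] at h
  exact h

/-- The first logarithmic derivative `x ∂ₓ` of the weighted theta series. -/
def thetaEuler (c : ℤ → ℝ) (x : ℝ) : ℝ := -x * thetaMoment c 1 x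

/-- The second logarithmic derivative `(x ∂ₓ)²` of the weighted theta series. -/
def thetaEuler₂ (c : ℤ → ℝ) (x : ℝ) : ℝ := x ^ 2 * thetaMoment c 2 x - x * thetaMoment c 1 x

lemma hasDerivAt_mul_exp (a t : ℝ) : HasDerivAt (fun t => a * exp t) (a * exp t) t :=
  (Real.hasDerivAt_exp t).const_mul a

lemma hasDerivAt_thetaMoment_exp {c : ℤ → ℝ} (hc : ∀ k, |c k| ≤ 1) {a : ℝ} (ha : 0 < a) (t : ℝ) :
    HasDerivAt (fun t => thetaMoment c 0 (a * exp t)) (thetaEuler c (a * exp t)) t := by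
  refine ((hasDerivAt_thetaMoment hc 0 (by positivity)).comp t
    (hasDerivAt_mul_exp a t)).congr_deriv ?_
  simp only [thetaEuler]
  ring

lemma hasDerivAt_thetaEuler_exp {c : ℤ → ℝ} (hc : ∀ k, |c k| ≤ 1) {a : ℝ} (ha : 0 < a) (t : ℝ) :
    HasDerivAt (fun t => thetaEuler c (a * exp t)) (thetaEuler₂ c (a * exp t)) t := by
  have h := hasDerivAt_mul_exp a t
  refine (h.neg.mul ((hasDerivAt_thetaMoment hc 1 (by positivity)).comp t h)).congr_deriv ?_
  simp only [thetaEuler₂, Function.comp_apply, Pi.neg_apply]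
  ring

lemma continuous_thetaEuler₂_exp {c : ℤ → ℝ} (hc : ∀ k, |c k| ≤ 1) {a : ℝ} (ha : 0 < a) :
    Continuous fun t => thetaEuler₂ c (a * exp t) := by
  have h (j : ℕ) : Continuous fun t => thetaMoment c j (a * exp t) :=
    continuous_iff_continuousAt.2 fun t =>
      ((hasDerivAt_thetaMoment hc j (by positivity)).comp t (hasDerivAt_mul_exp a t)).continuousAt
  have h1 := h 1
  have h2 := h 2
  unfold thetaEuler₂
  fun_prop

lemma hasDerivAt_mul_reflect {p p₁ : ℝ → ℝ} (hp : ∀ t, HasDerivAt p (p₁ t) t) {q q₁ : ℝ → ℝ}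
    (hq : ∀ t, HasDerivAt q (q₁ t) t) (t : ℝ) :
    HasDerivAt (fun t => p t * q (-t)) (p₁ t * q (-t) - p t * q₁ (-t)) t := by
  refine ((hp t).mul ((hq (-t)).comp t (hasDerivAt_neg t))).congr_deriv ?_
  simp only [Function.comp_apply]
  ring

lemma exists_perturbation_lt {f f₁ f₂ h h₁ h₂ : ℝ → ℝ} (hf : ∀ t, HasDerivAt f (f₁ t) t)
    (hf₁ : ∀ t, HasDerivAt f₁ (f₂ t) t) (hf₂ : ContinuousAt f₂ 0)
    (hh : ∀ t, HasDerivAt h (h₁ t) t) (hh₁ : ∀ t, HasDerivAt h₁ (h₂ t) t)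
    (hh₂ : ContinuousAt h₂ 0) (f₁_zero : f₁ 0 = 0) (f₂_zero : 0 < f₂ 0) (h₁_zero : h₁ 0 = 0)
    (f₁_pos : ∀ t, 0 < t → 0 < f₁ t) (h_nonneg : ∀ t, 0 ≤ h t) :
    ∃ ε₀ : ℝ, 0 < ε₀ ∧ ∀ ε, 0 ≤ ε → ε < ε₀ → ∀ t, 0 < t → f 0 + ε * h 0 < f t + ε * h t := by
  have hcomb : ContinuousAt (fun t => |h₂ 0| + 1 - |h₂ t|) 0 :=
    continuousAt_const.sub hh₂.abs
  obtain ⟨δ, hδ, hδ'⟩ := Metric.eventually_nhds_iff.1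
    ((hf₂.eventually_const_lt (half_lt_self f₂_zero)).and
      (hcomb.eventually_const_lt (u := 0) (by simp)))
  have hmono : StrictMonoOn f (Ici 0) := by
    refine strictMonoOn_of_hasDerivWithinAt_pos (f' := f₁) (convex_Ici 0)
      (fun t _ => (hf t).continuousAt.continuousWithinAt)
      (fun t _ => (hf t).hasDerivWithinAt) fun t ht => ?_
    rw [interior_Ici] at ht
    exact f₁_pos t ht
  set C := |h₂ 0| + 1
  have hC : 0 < C := by positivity
  have hgap : 0 < f (δ / 2) - f 0 :=
    sub_pos.2 (hmono self_mem_Ici (half_pos hδ).le (half_pos hδ))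
  refine ⟨min (f₂ 0 / 2 / C) ((f (δ / 2) - f 0) / (h 0 + 1)), ?_, fun ε hε hε' t ht => ?_⟩
  · have := h_nonneg 0
    exact lt_min (by positivity) (by positivity)
  obtain ⟨hε₁, hε₂⟩ := lt_min_iff.1 hε'
  rw [lt_div_iff₀ hC] at hε₁
  rw [lt_div_iff₀ (by linarith [h_nonneg 0])] at hε₂
  rcases le_or_gt (δ / 2) t with hδt | hδt
  · have := hmono.monotoneOn (half_pos hδ).le ht.le hδt
    nlinarith [mul_nonneg hε (h_nonneg t)]
  have hF (s) : HasDerivAt (fun s => f s + ε * h s) (f₁ s + ε * h₁ s) s :=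
    (hf s).add ((hh s).const_mul ε)
  have hF₁ (s) : HasDerivAt (fun s => f₁ s + ε * h₁ s) (f₂ s + ε * h₂ s) s :=
    (hf₁ s).add ((hh₁ s).const_mul ε)
  have hF₁_mono : StrictMonoOn (fun s => f₁ s + ε * h₁ s) (Icc 0 t) := by
    refine strictMonoOn_of_hasDerivWithinAt_pos (convex_Icc 0 t)
      (fun s _ => (hF₁ s).continuousAt.continuousWithinAt)
      (fun s _ => (hF₁ s).hasDerivWithinAt) fun s hs => ?_
    rw [interior_Icc] at hs
    have := hδ' (y := s) (by rw [dist_zero_right, norm_eq_abs, abs_of_pos hs.1]; linarith [hs.2])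
    nlinarith [mul_nonneg hε (sub_nonneg.2 (neg_abs_le (h₂ s))), mul_nonneg hε this.2.le]
  have hF_mono : StrictMonoOn (fun s => f s + ε * h s) (Icc 0 t) := by
    refine strictMonoOn_of_hasDerivWithinAt_pos (convex_Icc 0 t)
      (fun s _ => (hF s).continuousAt.continuousWithinAt)
      (fun s _ => (hF s).hasDerivWithinAt) fun s hs => ?_
    rw [interior_Icc] at hs
    simpa [f₁_zero, h₁_zero] using
      hF₁_mono (left_mem_Icc.2 ht.le) (Ioo_subset_Icc_self hs) hs.1
  exact hF_mono (left_mem_Icc.2 ht.le) (right_mem_Icc.2 ht.le) ht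

lemma exists_reflect_mul_perturbation_lt {p p₁ p₂ q q₁ q₂ : ℝ → ℝ}
    (hp : ∀ t, HasDerivAt p (p₁ t) t) (hp₁ : ∀ t, HasDerivAt p₁ (p₂ t) t) (hp₂ : Continuous p₂)
    (hq : ∀ t, HasDerivAt q (q₁ t) t) (hq₁ : ∀ t, HasDerivAt q₁ (q₂ t) t) (hq₂ : Continuous q₂)
    (p_pos : ∀ t, 0 < p t) (q_pos : ∀ t, 0 < q t) (hlog : ∀ t, p₁ t ^ 2 < p t * p₂ t) :
    ∃ ε₀ : ℝ, 0 < ε₀ ∧ ∀ ε, 0 ≤ ε → ε < ε₀ → ∀ t, t ≠ 0 →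
      p 0 ^ 2 + ε * q 0 ^ 2 < p t * p (-t) + ε * (q t * q (-t)) := by
  have cont {r r' : ℝ → ℝ} (hr : ∀ t, HasDerivAt r (r' t) t) : Continuous r :=
    continuous_iff_continuousAt.2 fun t => (hr t).continuousAt
  have := cont hp
  have := cont hp₁
  have := cont hq
  have := cont hq₁
  have hratio : StrictMono fun t => p₁ t / p t := by
    refine strictMono_of_deriv_pos fun t => ?_
    have hd := (hp₁ t).div (hp t) (p_pos t).ne'
    change 0 < deriv (p₁ / p) t
    rw [hd.deriv]
    exact div_pos (by nlinarith [hlog t]) (pow_pos (p_pos t) 2)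
  obtain ⟨ε₀, hε₀, H⟩ := exists_perturbation_lt
    (hasDerivAt_mul_reflect hp hp)
    (fun t => (hasDerivAt_mul_reflect hp₁ hp t).sub (hasDerivAt_mul_reflect hp hp₁ t))
    (by fun_prop)
    (hasDerivAt_mul_reflect hq hq)
    (fun t => (hasDerivAt_mul_reflect hq₁ hq t).sub (hasDerivAt_mul_reflect hq hq₁ t))
    (by fun_prop) (by simp; ring) (by simp; nlinarith [hlog 0]) (by simp; ring)
    (fun t ht => by
      have := hratio (show -t < t by linarith)
      dsimp only at this
      rw [div_lt_div_iff₀ (p_pos _) (p_pos _)] at this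
      linarith) (fun t => (mul_pos (q_pos _) (q_pos _)).le)
  refine ⟨ε₀, hε₀, fun ε hε hε' t ht => ?_⟩
  rcases ht.lt_or_gt with ht | ht
  · have := H ε hε hε' (-t) (by linarith)
    simp only [neg_neg, neg_zero] at this
    linarith [mul_comm (p t) (p (-t)), mul_comm (q t) (q (-t))]
  · have := H ε hε hε' t ht
    simp only [neg_zero] at this
    linarith

lemma theta3_eq_thetaMoment : theta3 = thetaMoment (fun _ => 1) 0 := by
  ext x
  simp [theta3, thetaMoment]

lemma theta4_eq_thetaMoment : theta4 = thetaMoment (fun k => (-1) ^ k) 0 := by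
  ext x
  simp [theta4, thetaMoment]

lemma evenKernel_pos (a : ℝ) {x : ℝ} (hx : 0 < x) : 0 < HurwitzZeta.evenKernel a x := by
  have h := HurwitzZeta.hasSum_int_evenKernel a hx
  rw [← h.tsum_eq]
  exact h.summable.tsum_pos (fun k => (exp_pos _).le) 0 (exp_pos _)

lemma theta3_eq_evenKernel {x : ℝ} (hx : 0 < x) : theta3 x = HurwitzZeta.evenKernel 0 x := by
  have h := HurwitzZeta.hasSum_int_evenKernel 0 hx
  rw [QuotientAddGroup.mk_zero] at h
  rw [← h.tsum_eq, theta3]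
  refine tsum_congr fun k => ?_
  ring_nf

lemma theta3_pos {x : ℝ} (hx : 0 < x) : 0 < theta3 x := by
  rw [theta3_eq_evenKernel hx, ← QuotientAddGroup.mk_zero]
  exact evenKernel_pos 0 hx

lemma theta3_functional_equation {x : ℝ} (hx : 0 < x) :
    theta3 x⁻¹ = x ^ (1 / 2 : ℝ) * theta3 x := by
  rw [theta3_eq_evenKernel hx, theta3_eq_evenKernel (inv_pos.2 hx),
    HurwitzZeta.evenKernel_functional_equation 0 x, HurwitzZeta.evenKernel_eq_cosKernel_of_zero,
    one_div x, ← mul_assoc, mul_one_div_cancel (rpow_pos_of_pos hx _).ne', one_mul]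

lemma theta4_eq_cosKernel {x : ℝ} (hx : 0 < x) :
    theta4 x = HurwitzZeta.cosKernel ((1 / 2 : ℝ) : UnitAddCircle) x := by
  have h := HurwitzZeta.hasSum_int_cosKernel (1 / 2) hx
  rw [← Complex.ofReal_inj, ← h.tsum_eq, theta4, Complex.ofReal_tsum]
  refine tsum_congr fun k => ?_
  have : Complex.exp (2 * π * Complex.I * ((1 / 2 : ℝ) : ℂ) * k) = (-1) ^ k := by
    rw [← Complex.exp_pi_mul_I, ← Complex.exp_int_mul]
    congr 1
    push_cast
    ring
  rw [this]
  push_cast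
  congr 2
  ring

lemma theta4_pos {x : ℝ} (hx : 0 < x) : 0 < theta4 x := by
  have h := evenKernel_pos (1 / 2) (inv_pos.2 hx)
  rw [HurwitzZeta.evenKernel_functional_equation, one_div x⁻¹, inv_inv,
    ← theta4_eq_cosKernel hx] at h
  exact pos_of_mul_pos_right h (by positivity)

lemma theta3_lt_pi {x : ℝ} (hx : 1 ≤ x) : theta3 x < π := by
  have hx0 : 0 < x := by linarith
  have him : (Complex.I * x).im = x := by simp
  have h := norm_jacobiTheta_sub_one_le (τ := Complex.I * x) (by rwa [him])
  have hθ : jacobiTheta (Complex.I * x) = (theta3 x : ℂ) := by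
    rw [theta3_eq_evenKernel hx0, HurwitzZeta.evenKernel_eq_cosKernel_of_zero,
      ← QuotientAddGroup.mk_zero, HurwitzZeta.cosKernel_def, jacobiTheta_eq_jacobiTheta₂,
      Complex.ofReal_zero]
  rw [hθ, him, ← Complex.ofReal_one, ← Complex.ofReal_sub, Complex.norm_real] at h
  have hq : exp (-π * x) < 1 / 4 := by
    have : exp (-π * x) ≤ exp (-3) := by
      rw [exp_le_exp]
      nlinarith [pi_gt_three]
    have h4' : (4 : ℝ) < exp 3 := by linarith [add_one_lt_exp (x := (3 : ℝ)) (by norm_num)]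
    rw [exp_neg 3] at this
    have := inv_strictAnti₀ (by norm_num) h4'
    linarith
  have hb : 2 / (1 - exp (-π * x)) * exp (-π * x) < 1 := by
    rw [div_mul_eq_mul_div, div_lt_one (by linarith)]
    linarith
  have := le_abs_self (theta3 x - 1)
  rw [norm_eq_abs] at h
  linarith [pi_gt_three]

lemma thetaMoment_one_sq_le {x : ℝ} (hx : 0 < x) :
    thetaMoment (fun _ => 1) 1 x ^ 2 ≤
      thetaMoment (fun _ => 1) 2 x * (thetaMoment (fun _ => 1) 0 x - 1) := by
  have hs (j : ℕ) := (summable_thetaMoment (c := fun _ => 1) (by simp) j hx).hasSum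
  have h0 := hasSum_ite_eq (0 : ℤ) (1 : ℝ)
  have key (l : ℝ) : 0 ≤ (thetaMoment (fun _ => 1) 0 x - 1) * (l * l)
      + (-2 * thetaMoment (fun _ => 1) 1 x) * l + thetaMoment (fun _ => 1) 2 x := by
    have := (((hs 0).sub h0).mul_right (l * l)).add (((hs 1).mul_left (-2)).mul_right l)
      |>.add (hs 2)
    refine this.nonneg fun k => ?_
    by_cases hk : k = 0
    · simp [hk]
    · simp only [hk, if_false]
      have : 0 ≤ (π * (k : ℝ) ^ 2 - l) ^ 2 * exp (-π * x * (k : ℝ) ^ 2) := by positivity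
      linarith
  have := discrim_le_zero key
  rw [discrim] at this
  linarith

lemma pi_mul_thetaMoment_one_le {x : ℝ} (hx : 0 < x) :
    π * thetaMoment (fun _ => 1) 1 x ≤ thetaMoment (fun _ => 1) 2 x := by
  have hs (j : ℕ) := (summable_thetaMoment (c := fun _ => 1) (by simp) j hx).hasSum
  refine hasSum_le (fun k => ?_) ((hs 1).mul_left π) (hs 2)
  have hk : (k : ℝ) ^ 2 ≤ (k : ℝ) ^ 2 * (k : ℝ) ^ 2 := by
    have : k ^ 2 ≤ k ^ 2 * k ^ 2 := by
      rcases eq_or_ne k 0 with rfl | hk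
      · simp
      · exact le_mul_of_one_le_left (sq_nonneg k) (Int.add_one_le_of_lt (sq_pos_of_ne_zero hk))
    exact_mod_cast this
  have := mul_le_mul_of_nonneg_left hk
    (show 0 ≤ π ^ 2 * exp (-π * x * (k : ℝ) ^ 2) by positivity)
  linarith

lemma thetaMoment_one_pos {x : ℝ} (hx : 0 < x) : 0 < thetaMoment (fun _ => 1) 1 x :=
  (summable_thetaMoment (c := fun _ => 1) (by simp) 1 hx).tsum_pos
    (fun k => by positivity) 1 (by simp; positivity)

lemma thetaEuler_sq_lt_of_one_le {x : ℝ} (hx : 1 ≤ x) :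
    thetaEuler (fun _ => 1) x ^ 2 < thetaMoment (fun _ => 1) 0 x * thetaEuler₂ (fun _ => 1) x := by
  have hx0 : 0 < x := by linarith
  have h1 := thetaMoment_one_sq_le hx0
  have h2 := pi_mul_thetaMoment_one_le hx0
  have h3 := thetaMoment_one_pos hx0
  have h4 := theta3_lt_pi hx
  have h5 := theta3_pos hx0
  rw [theta3_eq_thetaMoment] at h4 h5
  simp only [thetaEuler, thetaEuler₂]
  set A := thetaMoment (fun _ => 1) 0 x
  set B := thetaMoment (fun _ => 1) 1 x
  set C := thetaMoment (fun _ => 1) 2 x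
  have hBC : A * B < x * C :=
    ((mul_lt_mul_of_pos_right h4 h3).trans_le h2).trans_le
      (le_mul_of_one_le_left ((mul_pos pi_pos h3).le.trans h2) hx)
  nlinarith [mul_le_mul_of_nonneg_left h1 (sq_nonneg x), mul_lt_mul_of_pos_left hBC hx0]

lemma theta3_exp_neg (t : ℝ) : theta3 (exp (-t)) = exp (t / 2) * theta3 (exp t) := by
  rw [exp_neg, theta3_functional_equation (exp_pos t), ← exp_mul]
  ring_nf

lemma thetaEuler_sq_lt {x : ℝ} (hx : 0 < x) :
    thetaEuler (fun _ => 1) x ^ 2 < thetaMoment (fun _ => 1) 0 x * thetaEuler₂ (fun _ => 1) x := by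
  rcases le_total 1 x with h1 | h1
  · exact thetaEuler_sq_lt_of_one_le h1
  obtain ⟨s, rfl⟩ : ∃ s, x = exp (-s) := ⟨-log x, by rw [neg_neg, exp_log hx]⟩
  have hs : 1 ≤ exp s := by
    rw [exp_le_one_iff] at h1
    exact one_le_exp (by linarith)
  have hc : ∀ k : ℤ, |(fun _ : ℤ => (1 : ℝ)) k| ≤ 1 := by simp
  have hp (t) : HasDerivAt (fun t => thetaMoment (fun _ => 1) 0 (exp t))
      (thetaEuler (fun _ => 1) (exp t)) t := by
    simpa using hasDerivAt_thetaMoment_exp hc one_pos t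
  have hp₁ (t) : HasDerivAt (fun t => thetaEuler (fun _ => 1) (exp t))
      (thetaEuler₂ (fun _ => 1) (exp t)) t := by
    simpa using hasDerivAt_thetaEuler_exp hc one_pos t
  have he (t : ℝ) : HasDerivAt (fun t => exp (t / 2)) (exp (t / 2) * (1 / 2)) t :=
    ((hasDerivAt_id t).div_const 2).exp
  have e0 (t) : thetaMoment (fun _ => 1) 0 (exp (-t))
      = exp (t / 2) * thetaMoment (fun _ => 1) 0 (exp t) := by
    simpa only [theta3_eq_thetaMoment] using theta3_exp_neg t
  have e1 (t) : thetaEuler (fun _ => 1) (exp (-t))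
      = -(exp (t / 2) * (thetaMoment (fun _ => 1) 0 (exp t) / 2
        + thetaEuler (fun _ => 1) (exp t))) := by
    have hl := (hp (-t)).comp t (hasDerivAt_neg t)
    have hr := (he t).mul (hp t)
    have := hl.unique (hr.congr_of_eventuallyEq (.of_forall e0))
    linarith
  have e2 (t) : thetaEuler₂ (fun _ => 1) (exp (-t))
      = exp (t / 2) * (thetaMoment (fun _ => 1) 0 (exp t) / 4
        + thetaEuler (fun _ => 1) (exp t) + thetaEuler₂ (fun _ => 1) (exp t)) := by
    have hl := (hp₁ (-t)).comp t (hasDerivAt_neg t)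
    have hr := ((he t).mul (((hp t).div_const 2).add (hp₁ t))).neg
    have := hl.unique (hr.congr_of_eventuallyEq (.of_forall e1))
    simp only [Pi.add_apply] at this
    linarith
  rw [e0, e1, e2]
  have := mul_lt_mul_of_pos_left (thetaEuler_sq_lt_of_one_le hs) (pow_pos (exp_pos (s / 2)) 2)
  linarith

/-- For all sufficiently small `ε ≥ 0`, the square lattice is the unique
minimizer of the energy `E^±_{f₁,εf₂}` with Gaussian potentials among
rectangular lattices of covolume `V`. -/
theorem square_unique_minimizer_small_eps
    (α β V : ℝ) (hα : 0 < α) (hαβ : α < β) (hV : 0 < V) :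
    ∃ ε₀ : ℝ, 0 < ε₀ ∧ ∀ ε : ℝ, 0 ≤ ε → ε < ε₀ →
      ∀ y : ℝ, 0 < y → y ≠ 1 →
        theta3 (β * V * y) * theta3 (β * V / y)
            + ε * (theta4 (α * V * y) * theta4 (α * V / y))
          > theta3 (β * V) ^ 2 + ε * theta4 (α * V) ^ 2 := by
  have hc3 : ∀ k : ℤ, |(fun _ : ℤ => (1 : ℝ)) k| ≤ 1 := by simp
  have hc4 : ∀ k : ℤ, |(fun k : ℤ => (-1 : ℝ) ^ k) k| ≤ 1 := by simp [abs_zpow]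
  have ha : 0 < β * V := mul_pos (hα.trans hαβ) hV
  have hb : 0 < α * V := mul_pos hα hV
  obtain ⟨ε₀, hε₀, H⟩ := exists_reflect_mul_perturbation_lt
    (hasDerivAt_thetaMoment_exp hc3 ha) (hasDerivAt_thetaEuler_exp hc3 ha)
    (continuous_thetaEuler₂_exp hc3 ha)
    (hasDerivAt_thetaMoment_exp hc4 hb) (hasDerivAt_thetaEuler_exp hc4 hb)
    (continuous_thetaEuler₂_exp hc4 hb)
    (fun t => by rw [← theta3_eq_thetaMoment]; exact theta3_pos (by positivity))
    (fun t => by rw [← theta4_eq_thetaMoment]; exact theta4_pos (by positivity))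
    (fun t => thetaEuler_sq_lt (by positivity))
  refine ⟨ε₀, hε₀, fun ε hε hε' y hy hy1 => ?_⟩
  have := H ε hε hε' (Real.log y) (Real.log_ne_zero_of_pos_of_ne_one hy hy1)
  rw [Real.exp_neg, Real.exp_log hy, Real.exp_zero, mul_one, mul_one, ← div_eq_mul_inv,
    ← div_eq_mul_inv, ← theta3_eq_thetaMoment, ← theta4_eq_thetaMoment] at this
  exact this
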